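/- A 2-connected constraint graph (G,X) is constraint connected if and only if it has no constraint minor isomorphic to the 4-cycle whose constraint consists of two opposite (non-adjacent) edges. -/

import Mathlib

open SimpleGraph

/-- An edge set `X` is connected: any two vertices covered by `X` are joined by a path
consisting of edges of `X`.  (The empty edge set counts as connected.) -/
def EdgeSetConnected {V : Type*} (X : Set (Sym2 V)) : Prop :=
  ∀ u ∈ (fromEdgeSet X).support, ∀ v ∈ (fromEdgeSet X).support, (fromEdgeSet X).Reachable u v

/-- The subgraph `G[X]` spanned by an edge set `X`, as a graph on the covered vertices. -/
def edgeSubgraph {V : Type*} (X : Set (Sym2 V)) :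
    SimpleGraph ((fromEdgeSet X).support) :=
  (fromEdgeSet X).induce (fromEdgeSet X).support

/-- The number of connected components of `G[X]`. -/
noncomputable def edgeComponents {V : Type*} (X : Set (Sym2 V)) : ℕ :=
  Nat.card (edgeSubgraph X).ConnectedComponent

/-- A graph is `k`-connected if it has more than `k` vertices and deleting fewer than `k`
vertices always leaves a connected graph. -/
def KConnected {V : Type*} (k : ℕ) (G : SimpleGraph V) : Prop :=
  k < Nat.card V ∧ ∀ S : Set V, S.ncard < k → (G.induce Sᶜ).Connected

/-- A constraint graph: a finite simple graph `G` together with a set `X` of edges. -/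
structure CGraph : Type 1 where
  V : Type
  G : SimpleGraph V
  X : Set (Sym2 V)
  fin : Finite V := by infer_instance

attribute [instance] CGraph.fin

/-- `X` really is a set of edges of `G`. -/
def CGraph.WF (C : CGraph) : Prop := C.X ⊆ C.G.edgeSet

/-- The vertex map contracting `v` onto `u`. -/
noncomputable def contractFun {V : Type*} {u v : V} (huv : u ≠ v) (x : V) : {w : V // w ≠ v} :=
  letI := Classical.decEq V
  if h : x = v then ⟨u, huv⟩ else ⟨x, h⟩

/-- Contraction of a simple graph, identifying `v` with `u` (loops are discarded, parallel
edges are merged, so the result is simple). -/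
noncomputable def contractGraph {V : Type*} (G : SimpleGraph V) {u v : V} (huv : u ≠ v) :
    SimpleGraph {w : V // w ≠ v} :=
  fromEdgeSet (Sym2.map (contractFun huv) '' G.edgeSet)

/-- Contraction of a constraint graph: identify `v` with `u`; the new constraint consists of all
non-loop images of constraint edges; thus in each parallel class edges of `X` are preferred. -/
noncomputable def CGraph.contract (C : CGraph) (u v : C.V) (huv : u ≠ v) : CGraph where
  V := {w : C.V // w ≠ v}
  G := contractGraph C.G huv
  X := {e | e ∈ Sym2.map (contractFun huv) '' C.X ∧ ¬ e.IsDiag}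

/-- Deletion of an edge from a constraint graph. -/
def CGraph.deleteEdge (C : CGraph) (e : Sym2 C.V) : CGraph where
  V := C.V
  G := C.G.deleteEdges {e}
  X := C.X

/-- One step in forming a constraint minor: delete an edge not in `X`, or contract an edge. -/
inductive CMinorStep : CGraph → CGraph → Prop
  | del (C : CGraph) (e : Sym2 C.V) (he : e ∈ C.G.edgeSet) (hx : e ∉ C.X) :
      CMinorStep C (C.deleteEdge e)
  | contr (C : CGraph) (u v : C.V) (h : C.G.Adj u v) :
      CMinorStep C (C.contract u v h.ne)

/-- The constraint-minor relation. -/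
def IsCMinor : CGraph → CGraph → Prop := Relation.ReflTransGen CMinorStep

/-- Isomorphism of constraint graphs. -/
def CGIso (C D : CGraph) : Prop :=
  ∃ φ : C.G ≃g D.G, Sym2.map (⇑φ) '' C.X = D.X

/-- The constraint `K₄`. -/
def constraintK4 : CGraph where
  V := Fin 4
  G := ⊤
  X := {s(0, 1), s(2, 3)}

def wheelGraph : SimpleGraph (Fin 5) :=
  fromEdgeSet {s(0, 1), s(1, 2), s(2, 3), s(3, 0), s(0, 4), s(1, 4), s(2, 4), s(3, 4)}

/-- The constraint wheel. -/
def constraintWheel : CGraph where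
  V := Fin 5
  G := wheelGraph
  X := {s(0, 1), s(2, 3)}

/-- The prism `K₃ □ K₂`, with triangles `{0,1,2}` and `{3,4,5}`. -/
def prismGraph : SimpleGraph (Fin 6) :=
  fromEdgeSet {s(0, 1), s(1, 2), s(0, 2), s(3, 4), s(4, 5), s(3, 5), s(0, 3), s(1, 4), s(2, 5)}

def topEdges : Set (Sym2 (Fin 6)) := {s(0, 1), s(1, 2), s(0, 2)}
def botEdges : Set (Sym2 (Fin 6)) := {s(3, 4), s(4, 5), s(3, 5)}

/-- Constraint sets of the four constraint prisms: contained in the two triangles and meeting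
every vertex, inducing a spanning connected subgraph of each triangle. -/
def PrismConstraintSet (X : Set (Sym2 (Fin 6))) : Prop :=
  X ⊆ topEdges ∪ botEdges ∧
  EdgeSetConnected (X ∩ topEdges) ∧ (fromEdgeSet (X ∩ topEdges)).support = {0, 1, 2} ∧
  EdgeSetConnected (X ∩ botEdges) ∧ (fromEdgeSet (X ∩ botEdges)).support = {3, 4, 5}

/-- `C` is one of the four constraint prisms. -/
def IsConstraintPrism (C : CGraph) : Prop :=
  ∃ X, PrismConstraintSet X ∧ CGIso C (CGraph.mk (Fin 6) prismGraph X)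

/-- The six obstructions. -/
def IsObstruction (D : CGraph) : Prop :=
  CGIso D constraintK4 ∨ CGIso D constraintWheel ∨ IsConstraintPrism D

/-- The weird prism. -/
def weirdPrism : CGraph where
  V := Fin 6
  G := prismGraph
  X := {s(0, 3), s(1, 4), s(2, 5)}

/-- The Wagner graph `V₈`. -/
def wagnerGraph : SimpleGraph (Fin 8) :=
  fromEdgeSet {s(0, 1), s(1, 2), s(2, 3), s(3, 4), s(4, 5), s(5, 6), s(6, 7), s(7, 0),
    s(0, 4), s(1, 5), s(2, 6), s(3, 7)}

/-- The constraint Wagner graph: `X` is the complement of the 6-cycle `0-1-5-4-3-7-0`. -/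
def constraintWagner : CGraph where
  V := Fin 8
  G := wagnerGraph
  X := {s(1, 2), s(2, 3), s(5, 6), s(6, 7), s(0, 4), s(2, 6)}

/-- The Wagner prism. -/
def wagnerPrism : CGraph where
  V := Fin 6
  G := prismGraph
  X := {s(0, 3), s(1, 2), s(4, 5)}

/-- `(G, X)` has a 3-connected constraint minor whose constraint is disconnected. -/
def BadMinor (C : CGraph) : Prop :=
  ∃ C', IsCMinor C C' ∧ KConnected 3 C'.G ∧ ¬ EdgeSetConnected C'.X

/-- An edge `e ∉ X` is essential if neither `(G/e, X ∩ E(G/e))` nor `(G∖e, X)` has a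
3-connected constraint minor with disconnected constraint. -/
def Essential (C : CGraph) (e : Sym2 C.V) : Prop :=
  ¬ BadMinor (C.deleteEdge e) ∧
  ∀ u v, ∀ h : C.G.Adj u v, s(u, v) = e → ¬ BadMinor (C.contract u v h.ne)

/-- An edge joining two distinct components of `G[X]`. -/
def JoinsComponents {V : Type*} (X : Set (Sym2 V)) (e : Sym2 V) : Prop :=
  ∃ a b, e = s(a, b) ∧ a ∈ (fromEdgeSet X).support ∧ b ∈ (fromEdgeSet X).support ∧
    ¬ (fromEdgeSet X).Reachable a b

/-- The degree of a vertex. -/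
noncomputable def vdeg {V : Type*} (G : SimpleGraph V) (v : V) : ℕ := (G.neighborSet v).ncard

/-- The component of `G[X]` containing the edge `f` consists of the single edge `f`. -/
def SingleEdgeComponent {V : Type*} (X : Set (Sym2 V)) (f : Sym2 V) : Prop :=
  f ∈ X ∧ ∀ g ∈ X, (∃ a ∈ f, ∃ b ∈ g, (fromEdgeSet X).Reachable a b) → g = f

/-- The edges of `Q` with all endvertices in `S`: the edges of the side `Q[S]`. -/
def sideEdges {V : Type*} (Q : SimpleGraph V) (S : Set V) : Set (Sym2 V) :=
  {e | e ∈ Q.edgeSet ∧ ∀ v ∈ e, v ∈ S}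

/-- The edges of `Q` with one endvertex in `S` and one outside `S`. -/
def crossEdges {V : Type*} (Q : SimpleGraph V) (S : Set V) : Set (Sym2 V) :=
  {e | e ∈ Q.edgeSet ∧ (∃ v ∈ e, v ∈ S) ∧ ∃ v ∈ e, v ∉ S}

/-- `d` is a bond of `Q` with sides induced by `S` and `Sᶜ`. -/
def IsBondWith {V : Type*} (Q : SimpleGraph V) (d : Set (Sym2 V)) (S : Set V) : Prop :=
  S.Nonempty ∧ Sᶜ.Nonempty ∧ (Q.induce S).Connected ∧ (Q.induce Sᶜ).Connected ∧
    d = crossEdges Q S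

/-- `Q` is 3-connected along the bond `d` (with left side `S`): `Q` is 2-connected and no pair
of vertices, one from each side, separates `Q`. -/
def ThreeConnAlong {V : Type*} (Q : SimpleGraph V) (d : Set (Sym2 V)) (S : Set V) : Prop :=
  IsBondWith Q d S ∧ KConnected 2 Q ∧
    ∀ x ∈ S, ∀ y ∈ Sᶜ, (Q.induce ({x, y}ᶜ : Set V)).Preconnected

/-- One step of a special contraction minor: contract an edge not in the bond. -/
inductive SCMStep : CGraph → CGraph → Prop
  | contr (C : CGraph) (u v : C.V) (h : C.G.Adj u v) (hd : s(u, v) ∉ C.X) :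
      SCMStep C (C.contract u v h.ne)

/-- The special-contraction-minor relation. -/
def IsSCMinor : CGraph → CGraph → Prop := Relation.ReflTransGen SCMStep

/-- A proper (non-identical) special contraction minor. -/
def IsProperSCMinor : CGraph → CGraph → Prop := Relation.TransGen SCMStep

/-- The special `K₄`: `K₄` together with a bond of size 4. -/
def specialK4 : CGraph where
  V := Fin 4
  G := ⊤
  X := {s(0, 2), s(0, 3), s(1, 2), s(1, 3)}

/-- The special prism: the prism together with the bond complementing the two triangles. -/
def specialPrism : CGraph where
  V := Fin 6
  G := prismGraph
  X := {s(0, 3), s(1, 4), s(2, 5)}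

/-- `(Q, d)` is 3-connected along `d` and both sides of `d` contain edges. -/
def GoodAlong (C : CGraph) : Prop :=
  ∃ S : Set C.V, ThreeConnAlong C.G C.X S ∧
    (sideEdges C.G S).Nonempty ∧ (sideEdges C.G Sᶜ).Nonempty

/-- `(Q, d)` is irreducible. -/
def BondIrreducible (C : CGraph) : Prop :=
  (∃ S : Set C.V, ThreeConnAlong C.G C.X S) ∧
  ¬ ∃ C', IsProperSCMinor C C' ∧ GoodAlong C'

/-- An edge set forming a triangle. -/
def IsTriangle {V : Type*} (X : Set (Sym2 V)) : Prop :=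
  ∃ a b c : V, a ≠ b ∧ a ≠ c ∧ b ≠ c ∧ X = {s(a, b), s(b, c), s(a, c)}

/-- An edge set consisting of a single edge. -/
def IsSingleEdge {V : Type*} (X : Set (Sym2 V)) : Prop :=
  ∃ a b : V, a ≠ b ∧ X = {s(a, b)}

/-- `M` is (isomorphic to) the cycle matroid of `G`, via the bijection `f` between the ground
set of `M` and the edges of `G`: a set is independent iff its image is a forest. -/
def IsGraphicRep {α : Type} (M : Matroid α) {V : Type} (G : SimpleGraph V)
    (f : α → Sym2 V) : Prop :=
  Set.BijOn f M.E G.edgeSet ∧ ∀ I ⊆ M.E, (M.Indep I ↔ (fromEdgeSet (f '' I)).IsAcyclic)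

/-- The constraint matroid `(M, X)` is realisable. -/
def Realisable {α : Type} (M : Matroid α) (X : Set α) : Prop :=
  ∃ (V : Type) (_ : Finite V) (G : SimpleGraph V) (f : α → Sym2 V),
    IsGraphicRep M G f ∧ EdgeSetConnected (f '' X)

/-- Deletion of a set of elements from a matroid. -/
def Matroid.del {α : Type} (M : Matroid α) (D : Set α) : Matroid α := Matroid.restrict M (M.E \ D)

/-- Contraction of a set of elements of a matroid. -/
def Matroid.con {α : Type} (M : Matroid α) (C : Set α) : Matroid α :=
  Matroid.dual (Matroid.del (Matroid.dual M) C)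

/-- `(N, Y)` is a constraint minor of `(M, X)`: contract an arbitrary set `C` and delete a
set `D` of elements not in `X`. -/
def MatroidCMinor {α : Type} (M : Matroid α) (X : Set α) (N : Matroid α) (Y : Set α) : Prop :=
  ∃ C D : Set α, D ⊆ M.E \ X ∧ N = (M.con C).del D ∧ Y = X \ C

/-- `(N, Y)` is isomorphic, via the cycle matroid, to one of the six obstructions. -/
def MatroidObstruction {α : Type} (N : Matroid α) (Y : Set α) : Prop :=
  (∃ f : α → Sym2 (Fin 4), IsGraphicRep N constraintK4.G f ∧ f '' Y = constraintK4.X) ∨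
  (∃ f : α → Sym2 (Fin 5), IsGraphicRep N constraintWheel.G f ∧ f '' Y = constraintWheel.X) ∨
  (∃ X, PrismConstraintSet X ∧
    ∃ f : α → Sym2 (Fin 6), IsGraphicRep N prismGraph f ∧ f '' Y = X)

/-- The 4-cycle with constraint two opposite edges. -/
def constraintC4 : CGraph where
  V := Fin 4
  G := fromEdgeSet {s(0, 1), s(1, 2), s(2, 3), s(3, 0)}
  X := {s(0, 1), s(2, 3)}


section Core
variable {V : Type*}

/-- `Z` is closed under adjacency inside `A`. -/
def ClosedIn (G : SimpleGraph V) (A Z : Set V) : Prop :=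
  ∀ x ∈ Z, ∀ y ∈ A, G.Adj x y → y ∈ Z

/-- `A` is connected, formulated through cuts (the empty set counts as connected). -/
def Cn (G : SimpleGraph V) (A : Set V) : Prop :=
  ∀ Z ⊆ A, Z.Nonempty → ClosedIn G A Z → A ⊆ Z

/-- Every union of components of `A` meets `P`. -/
def Hits (G : SimpleGraph V) (A P : Set V) : Prop :=
  ∀ Z ⊆ A, Z.Nonempty → ClosedIn G A Z → ∃ x ∈ Z, x ∈ P

theorem exists_max_set [Finite V] (p : Set V → Prop) (h : ∃ A, p A) :
    ∃ A, p A ∧ ∀ B, p B → A ⊆ B → B ⊆ A := by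
  obtain ⟨A, hA⟩ := (Set.toFinite {A | p A}).exists_maximal h
  exact ⟨A, hA.1, fun B hB hAB => hA.2 hB hAB⟩

theorem exists_min_set [Finite V] (p : Set V → Prop) (h : ∃ A, p A) :
    ∃ A, p A ∧ ∀ B, p B → B ⊆ A → A ⊆ B := by
  obtain ⟨A, hA⟩ := (Set.toFinite {A | p A}).exists_minimal h
  exact ⟨A, hA.1, fun B hB hAB => hA.2 hB hAB⟩

theorem Cn.insert {G : SimpleGraph V} {A : Set V} (hA : Cn G A) {a v : V} (ha : a ∈ A)
    (hav : G.Adj a v) : Cn G (insert v A) := by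
  intro Z hZ hne hcl
  by_cases hvZ : v ∈ Z
  · have haZ : a ∈ Z := hcl v hvZ a (Or.inr ha) hav.symm
    have := hA (Z ∩ A) Set.inter_subset_right ⟨a, haZ, ha⟩
      (fun x hx y hy hxy => ⟨hcl x hx.1 y (Or.inr hy) hxy, hy⟩)
    rintro y (rfl | hy)
    · exact hvZ
    · exact (this hy).1
  · exfalso
    have hZA : Z ⊆ A := by
      intro x hx
      rcases hZ hx with rfl | h
      · exact absurd hx hvZ
      · exact h
    have := hA Z hZA hne (fun x hx y hy hxy => hcl x hx y (Or.inr hy) hxy)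
    exact hvZ (hcl a (this ha) v (Or.inl rfl) hav)

theorem Cn.singleton (G : SimpleGraph V) (v : V) : Cn G {v} := by
  intro Z hZ ⟨x, hx⟩ _ y hy
  have := hZ hx
  simp only [Set.mem_singleton_iff] at this hy
  subst this; subst hy; exact hx

/-- A component. -/
theorem exists_component [Finite V] (G : SimpleGraph V) {A P : Set V} (hA : Hits G A P) {z : V}
    (hz : z ∈ A) : ∃ C ⊆ A, z ∈ C ∧ Cn G C ∧ ∃ x ∈ C, x ∈ P := by
  obtain ⟨C, ⟨hCA, hzC, hC⟩, hmax⟩ := exists_max_set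
    (fun C : Set V => C ⊆ A ∧ z ∈ C ∧ Cn G C)
    ⟨{z}, by simpa using hz, rfl, Cn.singleton G z⟩
  refine ⟨C, hCA, hzC, hC, hA C hCA ⟨z, hzC⟩ ?_⟩
  intro x hx y hy hxy
  exact hmax (insert y C) ⟨Set.insert_subset hy hCA, Or.inr hzC, hC.insert hx hxy⟩
    (Set.subset_insert _ _) (Or.inl rfl)

/-- Disjoint connected subsets extend to a connected bipartition. -/
theorem extend_partition [Finite V] (G : SimpleGraph V) {U C D : Set V} (hU : Cn G U)
    (hCU : C ⊆ U) (hDU : D ⊆ U) (hC : Cn G C) (hD : Cn G D) (hCne : C.Nonempty)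
    (hdis : Disjoint C D) :
    ∃ C' D' : Set V, C ⊆ C' ∧ D ⊆ D' ∧ Cn G C' ∧ Cn G D' ∧ Disjoint C' D' ∧ C' ∪ D' = U := by
  obtain ⟨C', ⟨h1, h2, h3, h4⟩, hmax⟩ := exists_max_set
    (fun C' : Set V => C' ⊆ U ∧ C ⊆ C' ∧ Cn G C' ∧ Disjoint C' D) ⟨C, hCU, le_rfl, hC, hdis⟩
  obtain ⟨D', ⟨k1, k2, k3, k4⟩, kmax⟩ := exists_max_set
    (fun D' : Set V => D' ⊆ U ∧ D ⊆ D' ∧ Cn G D' ∧ Disjoint C' D') ⟨D, hDU, le_rfl, hD, h4⟩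
  refine ⟨C', D', h2, k2, h3, k3, k4, Set.Subset.antisymm (Set.union_subset h1 k1) ?_⟩
  refine hU _ (Set.union_subset h1 k1) (hCne.mono (h2.trans Set.subset_union_left)) ?_
  intro x hx y hy hxy
  by_contra hn
  simp only [Set.mem_union, not_or] at hn
  rcases hx with hx | hx
  · refine hn.1 (hmax (insert y C') ⟨Set.insert_subset hy h1, h2.trans (Set.subset_insert _ _),
      h3.insert hx hxy, ?_⟩ (Set.subset_insert _ _) (Or.inl rfl))
    rw [Set.disjoint_insert_left]
    exact ⟨fun h => hn.2 (k2 h), h4⟩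
  · refine hn.2 (kmax (insert y D') ⟨Set.insert_subset hy k1, k2.trans (Set.subset_insert _ _),
      k3.insert hx hxy, ?_⟩ (Set.subset_insert _ _) (Or.inl rfl))
    rw [Set.disjoint_insert_right]
    exact ⟨hn.1, k4⟩

/-- The key lemma: a bond separating `x` from `y`. -/
theorem bond_lemma [Finite V] (G : SimpleGraph V) {U P Q : Set V} (hU : Cn G U)
    (hP : ∃ p ∈ U, p ∈ P) (hQ : ∃ p ∈ U, p ∈ Q)
    (hcond : ∀ t ∈ U, ∀ W ⊆ U \ {t}, W.Nonempty → ClosedIn G (U \ {t}) W →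
      ∃ x ∈ W, x ∈ P ∨ x ∈ Q)
    {x y : V} (hx : x ∈ U) (hy : y ∈ U) (hxy : x ≠ y) :
    ∃ A ⊆ U, Hits G A P ∧ Hits G (U \ A) Q ∧ (x ∈ A ↔ y ∉ A) := by
  by_contra hcon
  push Not at hcon
  have hsep : ∀ A ⊆ U, Hits G A P → Hits G (U \ A) Q → (x ∈ A ↔ y ∈ A) := by
    intro A h1 h2 h3
    have := hcon A h1 h2 h3
    tauto
  obtain ⟨A, ⟨hAU, hAP, hAQ, hxA⟩, hmax⟩ := exists_max_set
    (fun A : Set V => A ⊆ U ∧ Hits G A P ∧ Hits G (U \ A) Q ∧ x ∉ A)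
    ⟨∅, by simp, by
      intro Z hZ hne; obtain ⟨a, ha⟩ := hne; exact absurd (hZ ha) (by simp), by
      intro Z hZ hne hcl
      simp only [Set.sdiff_empty] at hZ hcl
      obtain ⟨q, hq, hqQ⟩ := hQ
      exact ⟨q, hU Z hZ hne hcl hq, hqQ⟩, by simp⟩
  -- every admissible extension is trivial
  have key : ∀ W : Set V, W ⊆ U \ A → W.Nonempty → Hits G (A ∪ W) P →
      Hits G (U \ (A ∪ W)) Q → x ∈ W ∧ y ∈ W := by
    intro W hW hne h1 h2
    have hsub : A ∪ W ⊆ U := Set.union_subset hAU (fun a ha => (hW ha).1)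
    have hyA : y ∉ A := fun h => hxA ((hsep A hAU hAP hAQ).2 h)
    have h3 : x ∈ A ∪ W := by
      by_contra hn
      obtain ⟨a, ha⟩ := hne
      exact (hW ha).2 (hmax (A ∪ W) ⟨hsub, h1, h2, hn⟩ Set.subset_union_left (Or.inr ha))
    have h4 := (hsep _ hsub h1 h2).1 h3
    simp only [Set.mem_union] at h3 h4
    tauto
  -- touching vertices
  let touch : V → Prop := fun v => v ∈ P ∨ ∃ a ∈ A, G.Adj a v
  have hW : ∀ v ∈ U \ A, touch v → ∃ W ⊆ (U \ A) \ {v}, W.Nonempty ∧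
      ClosedIn G ((U \ A) \ {v}) W ∧ ∀ q ∈ W, q ∉ Q := by
    intro v hv htv
    by_contra hno
    push Not at hno
    have hk := key {v} (by simpa using hv) ⟨v, rfl⟩ (by
      intro Z hZ hne hcl
      by_cases hZA : ∃ a ∈ Z, a ∈ A
      · obtain ⟨a, haZ, haA⟩ := hZA
        obtain ⟨p, hp, hpP⟩ := hAP (Z ∩ A) Set.inter_subset_right ⟨a, haZ, haA⟩
          (fun b hb c hc hbc => ⟨hcl b hb.1 c (Or.inl hc) hbc, hc⟩)
        exact ⟨p, hp.1, hpP⟩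
      · have hvZ : v ∈ Z := by
          obtain ⟨b, hb⟩ := hne
          rcases hZ hb with h | h
          · exact absurd ⟨b, hb, h⟩ hZA
          · rw [Set.mem_singleton_iff] at h; rwa [← h]
        rcases htv with h | ⟨a, ha, hav⟩
        · exact ⟨v, hvZ, h⟩
        · exact absurd ⟨a, hcl v hvZ a (Or.inl ha) hav.symm, ha⟩ hZA) (by
      intro Z hZ hne hcl
      have he : U \ (A ∪ {v}) = (U \ A) \ {v} := by rw [Set.sdiff_sdiff]
      rw [he] at hZ hcl
      exact hno Z hZ hne hcl)
    exact hxy (hk.1.trans hk.2.symm)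
  have hWxy : ∀ v ∈ U \ A, ∀ W ⊆ (U \ A) \ {v}, W.Nonempty → ClosedIn G ((U \ A) \ {v}) W →
      (∀ q ∈ W, q ∉ Q) → x ∈ W ∧ y ∈ W := by
    intro v hv W hWs hne hcl hWQ
    refine key W (hWs.trans Set.sdiff_subset) hne ?_ ?_
    · intro Z hZ hZne hZcl
      by_cases hZA : ∃ a ∈ Z, a ∈ A
      · obtain ⟨a, haZ, haA⟩ := hZA
        obtain ⟨p, hp, hpP⟩ := hAP (Z ∩ A) Set.inter_subset_right ⟨a, haZ, haA⟩
          (fun b hb c hc hbc => ⟨hZcl b hb.1 c (Or.inl hc) hbc, hc⟩)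
        exact ⟨p, hp.1, hpP⟩
      · have hZW : Z ⊆ W := by
          intro b hb
          rcases hZ hb with h | h
          · exact absurd ⟨b, hb, h⟩ hZA
          · exact h
        obtain ⟨p, hp, hpPQ⟩ := hcond v hv.1 Z
          (fun b hb => ⟨(hWs (hZW hb)).1.1, (hWs (hZW hb)).2⟩) hZne (by
            intro b hb c hc hbc
            by_cases hcA : c ∈ A
            · exact hZcl b hb c (Or.inl hcA) hbc
            · exact hZcl b hb c (Or.inr (hcl b (hZW hb) c ⟨⟨hc.1, hcA⟩, hc.2⟩ hbc)) hbc)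
        rcases hpPQ with h | h
        · exact ⟨p, hp, h⟩
        · exact absurd h (hWQ p (hZW hp))
    · intro Z hZ hZne hZcl
      by_contra hno
      push Not at hno
      by_cases hvZ : v ∈ Z
      · obtain ⟨q, hq, hqQ⟩ := hAQ (Z ∪ W)
          (Set.union_subset (fun b hb => ⟨(hZ hb).1, fun h => (hZ hb).2 (Or.inl h)⟩)
            (hWs.trans Set.sdiff_subset)) (hZne.mono Set.subset_union_left) (by
            intro b hb c hc hbc
            by_cases hcW : c ∈ W
            · exact Or.inr hcW
            left
            rcases hb with hb | hb
            · refine hZcl b hb c ⟨hc.1, ?_⟩ hbc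
              rintro (h | h)
              · exact hc.2 h
              · exact hcW h
            · by_cases hcv : c = v
              · rwa [hcv]
              · exact absurd (hcl b hb c ⟨hc, hcv⟩ hbc) hcW)
        rcases hq with hq | hq
        · exact hno q hq hqQ
        · exact hWQ q hq hqQ
      · obtain ⟨q, hq, hqQ⟩ := hAQ Z
          (fun b hb => ⟨(hZ hb).1, fun h => (hZ hb).2 (Or.inl h)⟩) hZne (by
            intro b hb c hc hbc
            by_cases hcW : c ∈ W
            · exfalso
              have hbW := hcl c hcW b ⟨⟨(hZ hb).1, fun h => (hZ hb).2 (Or.inl h)⟩, by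
                rintro rfl; exact hvZ hb⟩ hbc.symm
              exact (hZ hb).2 (Or.inr hbW)
            · refine hZcl b hb c ⟨hc.1, ?_⟩ hbc
              rintro (h | h)
              · exact hc.2 h
              · exact hcW h)
        exact hno q hq hqQ
  have htouch : ∃ v ∈ U \ A, touch v := by
    by_cases hA : A.Nonempty
    · by_contra hno
      push Not at hno
      refine hxA (hU A hAU hA ?_ hx)
      intro a ha b hb hab
      by_contra hbA
      exact hno b ⟨hb, hbA⟩ (Or.inr ⟨a, ha, hab⟩)
    · obtain ⟨p, hp, hpP⟩ := hP
      exact ⟨p, ⟨hp, fun h => hA ⟨p, h⟩⟩, Or.inl hpP⟩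
  obtain ⟨W, ⟨v, hv, htv, hWs, hWne, hWcl, hWQ⟩, hmin⟩ := exists_min_set
    (fun W : Set V => ∃ v ∈ U \ A, touch v ∧ W ⊆ (U \ A) \ {v} ∧ W.Nonempty ∧
      ClosedIn G ((U \ A) \ {v}) W ∧ ∀ q ∈ W, q ∉ Q) (by
      obtain ⟨v, hv, htv⟩ := htouch
      obtain ⟨W, h⟩ := hW v hv htv
      exact ⟨W, v, hv, htv, h⟩)
  have hxW := (hWxy v hv W hWs hWne hWcl hWQ).1
  obtain ⟨v', hv'W, htv'⟩ : ∃ v' ∈ W, touch v' := by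
    by_contra hno
    push Not at hno
    obtain ⟨p, hp, hpPQ⟩ := hcond v hv.1 W
      (fun b hb => ⟨(hWs hb).1.1, (hWs hb).2⟩) hWne (by
        intro b hb c hc hbc
        by_cases hcA : c ∈ A
        · exact absurd (Or.inr ⟨c, hcA, hbc.symm⟩) (hno b hb)
        · exact hWcl b hb c ⟨⟨hc.1, hcA⟩, hc.2⟩ hbc)
    rcases hpPQ with h | h
    · exact hno p hp (Or.inl h)
    · exact hWQ p hp h
  have hv'U := (hWs hv'W).1
  obtain ⟨W', hW's, hW'ne, hW'cl, hW'Q⟩ := hW v' hv'U htv'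
  have hxW' := (hWxy v' hv'U W' hW's hW'ne hW'cl hW'Q).1
  have hvW' : v ∉ W' := by
    intro hvW'
    obtain ⟨q, hq, hqQ⟩ := hAQ (W ∪ W')
      (Set.union_subset (hWs.trans Set.sdiff_subset) (hW's.trans Set.sdiff_subset))
      (hWne.mono Set.subset_union_left) (by
        intro b hb c hc hbc
        by_cases hcv : c = v
        · right; rwa [hcv]
        by_cases hcv' : c = v'
        · left; rwa [hcv']
        rcases hb with hb | hb
        · exact Or.inl (hWcl b hb c ⟨hc, hcv⟩ hbc)
        · exact Or.inr (hW'cl b hb c ⟨hc, hcv'⟩ hbc))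
    rcases hq with hq | hq
    · exact hWQ q hq hqQ
    · exact hW'Q q hq hqQ
  have := hmin (W ∩ W') ⟨v', hv'U, htv', fun b hb => hW's hb.2, ⟨x, hxW, hxW'⟩, by
      intro b hb c hc hbc
      have h1 := hW'cl b hb.2 c hc hbc
      refine ⟨hWcl b hb.1 c ⟨hc.1, ?_⟩ hbc, h1⟩
      rintro rfl
      exact hvW' h1, fun q hq => hWQ q hq.1⟩ Set.inter_subset_left hv'W
  exact (hW's this.2).2 rfl

/-- The two disjoint paths lemma, in partition form. -/
theorem split_lemma [Finite V] (G : SimpleGraph V) {U P Q : Set V} (hU : Cn G U)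
    (hP : ∃ p ∈ U, p ∈ P) (hQ : ∃ p ∈ U, p ∈ Q)
    (hcond : ∀ t ∈ U, ∀ W ⊆ U \ {t}, W.Nonempty → ClosedIn G (U \ {t}) W →
      ∃ x ∈ W, x ∈ P ∨ x ∈ Q)
    {x y : V} (hx : x ∈ U) (hy : y ∈ U) (hxy : x ≠ y) :
    ∃ C D : Set V, Cn G C ∧ Cn G D ∧ Disjoint C D ∧ C ∪ D = U ∧
      (∃ p ∈ C, p ∈ P) ∧ (∃ q ∈ D, q ∈ Q) ∧ (x ∈ C ∧ y ∈ D ∨ y ∈ C ∧ x ∈ D) := by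
  obtain ⟨A, hAU, hAP, hAQ, hsep⟩ := bond_lemma G hU hP hQ hcond hx hy hxy
  have main : ∀ a b : V, a ∈ A → b ∈ U \ A → ∃ C D : Set V, Cn G C ∧ Cn G D ∧ Disjoint C D ∧
      C ∪ D = U ∧ (∃ p ∈ C, p ∈ P) ∧ (∃ q ∈ D, q ∈ Q) ∧ a ∈ C ∧ b ∈ D := by
    intro a b ha hb
    obtain ⟨C, hCA, haC, hC, p, hpC, hpP⟩ := exists_component G hAP ha
    obtain ⟨D, hDA, hbD, hD, q, hqD, hqQ⟩ := exists_component G hAQ hb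
    obtain ⟨C', D', h1, h2, h3, h4, h5, h6⟩ := extend_partition G hU (hCA.trans hAU)
      (hDA.trans Set.sdiff_subset) hC hD ⟨a, haC⟩
      (Set.disjoint_of_subset hCA hDA Set.disjoint_sdiff_right)
    exact ⟨C', D', h3, h4, h5, h6, ⟨p, h1 hpC, hpP⟩, ⟨q, h2 hqD, hqQ⟩, h1 haC, h2 hbD⟩
  by_cases h : x ∈ A
  · obtain ⟨C, D, h1, h2, h3, h4, h5, h6, h7⟩ := main x y h ⟨hy, hsep.1 h⟩
    exact ⟨C, D, h1, h2, h3, h4, h5, h6, Or.inl h7⟩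
  · obtain ⟨C, D, h1, h2, h3, h4, h5, h6, h7⟩ := main y x (by tauto) ⟨hx, h⟩
    exact ⟨C, D, h1, h2, h3, h4, h5, h6, Or.inr h7⟩

/-- First bipartition: no constraint edge crosses. -/
theorem first_partition [Finite V] (G : SimpleGraph V) (X : Set (Sym2 V)) (hX : X ⊆ G.edgeSet)
    (hG : Cn G Set.univ) {a b : V} (hab : ¬ (fromEdgeSet X).Reachable a b) :
    ∃ S : Set V, a ∈ S ∧ b ∉ S ∧ Cn G S ∧ Cn G Sᶜ ∧ ∀ u ∈ S, ∀ v, s(u, v) ∈ X → v ∈ S := by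
  obtain ⟨S, ⟨haS, hbS, hS, hSX⟩, hmax⟩ := exists_max_set
    (fun S : Set V => a ∈ S ∧ b ∉ S ∧ Cn G S ∧ ∀ u ∈ S, ∀ v, s(u, v) ∈ X → v ∈ S)
    ⟨{v | (fromEdgeSet X).Reachable a v}, Reachable.refl _, hab, by
      have hle : ∀ u v, (fromEdgeSet X).Adj u v → G.Adj u v := by
        intro u v h
        exact hX ((fromEdgeSet_adj X).1 h).1
      intro Z hZ ⟨c, hc⟩ hcl d hd
      have hcd : (fromEdgeSet X).Reachable c d := (hZ hc).symm.trans hd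
      obtain ⟨w⟩ := hcd
      have hca : (fromEdgeSet X).Reachable a c := hZ hc
      clear hd
      induction w with
      | nil => exact hc
      | cons h p ih =>
        have := hca.trans h.reachable
        exact ih (hcl _ hc _ this (hle _ _ h)) this, by
      intro u hu v huv
      by_cases h : u = v
      · rwa [← h]
      · exact Reachable.trans hu (Adj.reachable ((fromEdgeSet_adj X).2 ⟨huv, h⟩))⟩
  refine ⟨S, haS, hbS, hS, ?_, hSX⟩
  -- a closed subset of the complement avoiding b is empty
  have hno : ∀ W ⊆ Sᶜ, W.Nonempty → ClosedIn G Sᶜ W → b ∈ W := by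
    intro W hW hne hcl
    by_contra hbW
    obtain ⟨w, hw⟩ := hne
    refine hW hw (hmax (S ∪ W) ⟨Or.inl haS, ?_, ?_, ?_⟩ Set.subset_union_left (Or.inr hw))
    · rintro (h | h)
      · exact hbS h
      · exact hbW h
    · intro Z hZ hZne hZcl
      by_cases hZS : ∃ c ∈ Z, c ∈ S
      · obtain ⟨c, hcZ, hcS⟩ := hZS
        have hSZ : S ⊆ Z := fun d hd => (hS (Z ∩ S) Set.inter_subset_right ⟨c, hcZ, hcS⟩
          (fun e he f hf hef => ⟨hZcl e he.1 f (Or.inl hf) hef, hf⟩) hd).1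
        by_contra hn
        rw [Set.not_subset] at hn
        obtain ⟨d, hd, hdZ⟩ := hn
        have hall := hG (W \ Z) (Set.subset_univ _)
          ⟨d, hd.resolve_left (fun h => hdZ (hSZ h)), hdZ⟩ (by
            intro e he f _ hef
            have hfZ : f ∉ Z := fun hf => he.2 (hZcl f hf e (Or.inr he.1) hef.symm)
            exact ⟨hcl e he.1 f (fun h => hfZ (hSZ h)) hef, hfZ⟩)
        exact (hall (Set.mem_univ c)).2 hcZ
      · exfalso
        have hZW : Z ⊆ W := by
          intro e he
          rcases hZ he with h | h
          · exact absurd ⟨e, he, h⟩ hZS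
          · exact h
        have hall := hG Z (Set.subset_univ _) hZne (by
          intro e he f _ hef
          by_cases hf : f ∈ S
          · exact hZcl e he f (Or.inl hf) hef
          · exact hZcl e he f (Or.inr (hcl e (hZW he) f hf hef)) hef)
        exact hZS ⟨a, hall (Set.mem_univ a), haS⟩
    · rintro u (hu | hu) v huv
      · exact Or.inl (hSX u hu v huv)
      · by_cases hv : v ∈ S
        · exact Or.inl hv
        · exact Or.inr (hcl u hu v hv (hX huv))
  intro Z hZ hne hcl d hd
  by_contra hdZ
  have h1 := hno Z hZ hne hcl
  have h2 := hno (Sᶜ \ Z) Set.sdiff_subset ⟨d, hd, hdZ⟩ (by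
    intro e he f hf hef
    exact ⟨hf, fun hfZ => he.2 (hcl f hfZ e he.1 hef.symm)⟩)
  exact h2.2 h1

/-- Induced connectivity gives cut connectivity. -/
theorem Cn.of_induce {G : SimpleGraph V} {A : Set V} (h : (G.induce A).Connected) : Cn G A := by
  intro Z hZ ⟨c, hc⟩ hcl d hd
  obtain ⟨w⟩ := h.preconnected ⟨c, hZ hc⟩ ⟨d, hd⟩
  have : ∀ (p q : A), (G.induce A).Walk p q → p.1 ∈ Z → q.1 ∈ Z := by
    intro p q w
    induction w with
    | nil => exact id
    | cons h p ih => exact fun hp => ih (hcl _ hp _ (Subtype.prop _) h)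
  exact this _ _ w hc

/-- The four parts. -/
theorem four_parts [Finite V] (G : SimpleGraph V) (X : Set (Sym2 V)) (hX : X ⊆ G.edgeSet)
    (hG : Cn G Set.univ) (hG1 : ∀ v, Cn G {v}ᶜ) (hdis : ¬ EdgeSetConnected X) :
    ∃ A B C D : Set V, Cn G A ∧ Cn G B ∧ Cn G C ∧ Cn G D ∧ Disjoint A B ∧ Disjoint C D ∧
      A ∪ B = (C ∪ D)ᶜ ∧ (∀ u ∈ A ∪ B, ∀ v, s(u, v) ∈ X → v ∈ A ∪ B) ∧
      (∃ a ∈ A, ∃ b ∈ B, s(a, b) ∈ X) ∧ (∃ b ∈ B, ∃ c ∈ C, G.Adj b c) ∧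
      (∃ c ∈ C, ∃ d ∈ D, s(c, d) ∈ X) ∧ (∃ d ∈ D, ∃ a ∈ A, G.Adj d a) := by
  unfold EdgeSetConnected at hdis
  push Not at hdis
  obtain ⟨x, ⟨y, hxy⟩, z, ⟨w, hzw⟩, hnr⟩ := hdis
  replace hxy := (fromEdgeSet_adj X).1 hxy
  replace hzw := (fromEdgeSet_adj X).1 hzw
  obtain ⟨S, hxS, hzS, hS, hT, hSX⟩ := first_partition G X hX hG hnr
  have hyS := hSX x hxS y hxy.1
  have hwS : w ∉ S := fun h => hzS (hSX w h z (by rw [Sym2.eq_swap]; exact hzw.1))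
  obtain ⟨s0, hs0, t0, ht0, hst0⟩ : ∃ s ∈ S, ∃ t ∈ Sᶜ, G.Adj s t := by
    by_contra hno
    push Not at hno
    exact hzS (hG S (Set.subset_univ _) ⟨x, hxS⟩ (by
      intro e he f _ hef
      by_contra hf
      exact hno e he f hf hef) (Set.mem_univ z))
  have hcond : ∀ R : Set V, Rᶜ.Nonempty → ∀ t ∈ R, ∀ W ⊆ R \ {t}, W.Nonempty →
      ClosedIn G (R \ {t}) W → ∃ x ∈ W, ∃ r ∈ Rᶜ, G.Adj x r := by
    intro R ⟨r, hr⟩ t ht W hW hne hcl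
    by_contra hno
    push Not at hno
    have := hG1 t W (fun b hb => (hW hb).2) hne (by
      intro e he f hf hef
      by_cases hfR : f ∈ R
      · exact hcl e he f ⟨hfR, hf⟩ hef
      · exact absurd hef (hno e he f hfR))
    have hrW : r ∈ W := this (by rintro rfl; exact hr ht)
    exact hr (hW hrW).1
  obtain ⟨A, B, hA, hB, hAB, hABS, ⟨p, hpA, hpP⟩, ⟨q, hqB, hqQ⟩, hxyAB⟩ :=
    split_lemma G (U := S) (P := {s | ∃ t ∈ Sᶜ, G.Adj s t}) (Q := {s | ∃ t ∈ Sᶜ, G.Adj s t}) hS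
      ⟨s0, hs0, t0, ht0, hst0⟩ ⟨s0, hs0, t0, ht0, hst0⟩ (by
        intro t ht W hW hne hcl
        obtain ⟨e, he, h⟩ := hcond S ⟨z, hzS⟩ t ht W hW hne hcl
        exact ⟨e, he, Or.inl h⟩) hxS hyS hxy.2
  obtain ⟨p', hp'S, hpp'⟩ := hpP
  obtain ⟨q', hq'S, hqq'⟩ := hqQ
  obtain ⟨D, C, hD, hC, hDC, hDCS, ⟨d, hdD, a, haA, hda⟩, ⟨c, hcC, b, hbB, hcb⟩, hzwDC⟩ :=
    split_lemma G (U := Sᶜ) (P := {s | ∃ t ∈ A, G.Adj s t}) (Q := {s | ∃ t ∈ B, G.Adj s t}) hT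
      ⟨p', hp'S, p, hpA, hpp'.symm⟩ ⟨q', hq'S, q, hqB, hqq'.symm⟩ (by
        intro t ht W hW hne hcl
        obtain ⟨e, he, r, hr, h⟩ := hcond Sᶜ (by rw [compl_compl]; exact ⟨x, hxS⟩) t ht W hW hne hcl
        rw [compl_compl, ← hABS] at hr
        rcases hr with hr | hr
        · exact ⟨e, he, Or.inl ⟨r, hr, h⟩⟩
        · exact ⟨e, he, Or.inr ⟨r, hr, h⟩⟩) hzS hwS hzw.2
  refine ⟨A, B, C, D, hA, hB, hC, hD, hAB, hDC.symm, ?_, ?_, ?_, ⟨b, hbB, c, hcC, hcb.symm⟩, ?_,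
    ⟨d, hdD, a, haA, hda⟩⟩
  · rw [Set.union_comm C D, hDCS, compl_compl, hABS]
  · rw [hABS]; exact hSX
  · rcases hxyAB with ⟨h1, h2⟩ | ⟨h1, h2⟩
    · exact ⟨x, h1, y, h2, hxy.1⟩
    · exact ⟨y, h1, x, h2, by rw [Sym2.eq_swap]; exact hxy.1⟩
  · rcases hzwDC with ⟨h1, h2⟩ | ⟨h1, h2⟩
    · exact ⟨w, h2, z, h1, by rw [Sym2.eq_swap]; exact hzw.1⟩
    · exact ⟨z, h2, w, h1, hzw.1⟩

end Core


section Minor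

theorem contractFun_val_of_ne {V : Type*} {u v : V} (huv : u ≠ v) {x : V} (h : x ≠ v) :
    contractFun huv x = ⟨x, h⟩ := by
  simp [contractFun, h]

theorem contractFun_self {V : Type*} {u v : V} (huv : u ≠ v) :
    contractFun huv v = ⟨u, huv⟩ := by
  simp [contractFun]

theorem contractFun_comp {V W : Type*} {u v : V} (huv : u ≠ v) (f : V → W) (hf : f u = f v)
    (x : V) : f (contractFun huv x).1 = f x := by
  by_cases h : x = v
  · subst h; rw [contractFun_self]; exact hf
  · rw [contractFun_val_of_ne huv h]

theorem contract_adj {V : Type*} {G : SimpleGraph V} {u v : V} (huv : u ≠ v) {x y : V}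
    (h : G.Adj x y) (hne : contractFun huv x ≠ contractFun huv y) :
    (contractGraph G huv).Adj (contractFun huv x) (contractFun huv y) := by
  rw [contractGraph, fromEdgeSet_adj]
  exact ⟨⟨s(x, y), h, rfl⟩, hne⟩

theorem isCMinor_deleteEdge (C : CGraph) (e : Sym2 C.V) (he : e ∉ C.X) :
    IsCMinor C (C.deleteEdge e) := by
  by_cases h : e ∈ C.G.edgeSet
  · exact Relation.ReflTransGen.single (CMinorStep.del C e h he)
  · have : C.deleteEdge e = C := by
      have h2 : C.G.deleteEdges {e} = C.G := by
        rw [deleteEdges_eq_self]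
        simpa using h
      cases C
      simp only [CGraph.deleteEdge] at h2 ⊢
      simp only [h2]
    rw [this]
    exact Relation.ReflTransGen.refl

/-- A model of the constraint `C₄` in `C`. -/
structure Model (C : CGraph) (f : C.V → Fin 4) : Prop where
  wf : C.WF
  cn : ∀ i, Cn C.G (f ⁻¹' {i})
  xs : ∀ u v, s(u, v) ∈ C.X → f u = f v ∨ s(f u, f v) ∈ ({s(0, 1), s(2, 3)} : Set (Sym2 (Fin 4)))
  e01 : ∃ a b, f a = 0 ∧ f b = 1 ∧ s(a, b) ∈ C.X
  e12 : ∃ a b, f a = 1 ∧ f b = 2 ∧ C.G.Adj a b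
  e23 : ∃ a b, f a = 2 ∧ f b = 3 ∧ s(a, b) ∈ C.X
  e30 : ∃ a b, f a = 3 ∧ f b = 0 ∧ C.G.Adj a b

theorem Model.contract {C : CGraph} {f : C.V → Fin 4} (M : Model C f) {u v : C.V}
    (huv : u ≠ v) (hf : f u = f v) : Model (C.contract u v huv) (fun x => f x.1) := by
  have hc : ∀ x, f (contractFun huv x).1 = f x := contractFun_comp huv f hf
  have hne : ∀ x y, f x ≠ f y → contractFun huv x ≠ contractFun huv y := by
    intro x y h h'
    apply h
    rw [← hc x, ← hc y, h']
  have hX : ∀ x y, f x ≠ f y → s(x, y) ∈ C.X →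
      s(contractFun huv x, contractFun huv y) ∈ (C.contract u v huv).X := by
    intro x y h hxy
    exact ⟨⟨s(x, y), hxy, rfl⟩, by simpa using hne x y h⟩
  refine ⟨?_, ?_, ?_, ?_, ?_, ?_, ?_⟩
  · rintro e ⟨⟨e', he', rfl⟩, hd⟩
    induction e' with | _ x y =>
    have hd' : contractFun huv x ≠ contractFun huv y := by simpa using hd
    exact contract_adj huv (M.wf he') hd'
  · intro i Z hZ hne' hcl
    have hsurj : ∀ w : {w : C.V // w ≠ v}, contractFun huv w.1 = w :=
      fun w => contractFun_val_of_ne huv w.2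
    have := M.cn i {x | contractFun huv x ∈ Z} (by
        intro x hx
        have := hZ hx
        simp only [Set.mem_preimage, Set.mem_singleton_iff] at this ⊢
        rw [← hc x]; exact this) (by
        obtain ⟨w, hw⟩ := hne'
        exact ⟨w.1, (congrArg (· ∈ Z) (hsurj w)).mpr hw⟩) (by
        intro x hx y hy hxy
        by_cases h : contractFun huv x = contractFun huv y
        · change contractFun huv y ∈ Z
          rw [← h]; exact hx
        · refine hcl _ hx _ ?_ (contract_adj huv hxy h)
          exact (hc y).trans hy)
    intro w hw
    have h2 := this (a := w.1) hw
    exact (congrArg (· ∈ Z) (hsurj w)).mp h2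
  · rintro p q ⟨⟨e', he', hpq⟩, hd⟩
    induction e' with | _ x y =>
    have h1 := M.xs x y he'
    replace hpq := Sym2.eq_iff.1 hpq
    rcases hpq with ⟨rfl, rfl⟩ | ⟨rfl, rfl⟩
    · simpa only [hc] using h1
    · simp only [hc]
      rw [Sym2.eq_swap (a := f y), eq_comm]; exact h1
  · obtain ⟨a, b, ha, hb, h⟩ := M.e01
    exact ⟨_, _, (hc a).trans ha, (hc b).trans hb, hX a b (by simp [ha, hb]) h⟩
  · obtain ⟨a, b, ha, hb, h⟩ := M.e12
    exact ⟨_, _, (hc a).trans ha, (hc b).trans hb,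
      contract_adj huv h (hne a b (by simp [ha, hb]))⟩
  · obtain ⟨a, b, ha, hb, h⟩ := M.e23
    exact ⟨_, _, (hc a).trans ha, (hc b).trans hb, hX a b (by simp [ha, hb]) h⟩
  · obtain ⟨a, b, ha, hb, h⟩ := M.e30
    exact ⟨_, _, (hc a).trans ha, (hc b).trans hb,
      contract_adj huv h (hne a b (by simp [ha, hb]))⟩

theorem Model.of_injective {C : CGraph} {f : C.V → Fin 4} (M : Model C f)
    (hf : Function.Injective f) : ∃ D, IsCMinor C D ∧ CGIso D constraintC4 := by
  obtain ⟨a, b, ha, hb, hab⟩ := M.e01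
  obtain ⟨c, d, hc, hd, hcd⟩ := M.e23
  obtain ⟨b', c', hb', hc', hbc⟩ := M.e12
  obtain ⟨d', a', hd', ha', hda⟩ := M.e30
  obtain rfl : b = b' := hf (hb.trans hb'.symm)
  obtain rfl : c = c' := hf (hc.trans hc'.symm)
  obtain rfl : d = d' := hf (hd.trans hd'.symm)
  obtain rfl : a = a' := hf (ha.trans ha'.symm)
  have hab' : C.G.Adj a b := M.wf hab
  have hcd' : C.G.Adj c d := M.wf hcd
  have hsurj : Function.Surjective f := by
    intro i
    fin_cases i
    exacts [⟨a, ha⟩, ⟨b, hb⟩, ⟨c, hc⟩, ⟨d, hd⟩]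
  have h4 : ∀ v, v = a ∨ v = b ∨ v = c ∨ v = d := by
    intro v
    have : f v = 0 ∨ f v = 1 ∨ f v = 2 ∨ f v = 3 := by
      generalize f v = i; revert i; decide
    rcases this with h | h | h | h
    · exact Or.inl (hf (h.trans ha.symm))
    · exact Or.inr (Or.inl (hf (h.trans hb.symm)))
    · exact Or.inr (Or.inr (Or.inl (hf (h.trans hc.symm))))
    · exact Or.inr (Or.inr (Or.inr (hf (h.trans hd.symm))))
  have hac : s(a, c) ∉ C.X := by
    intro h
    have := M.xs _ _ h
    rw [ha, hc] at this
    simp at this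
  have hbd : s(b, d) ∉ C.X := by
    intro h
    have := M.xs _ _ h
    rw [hb, hd] at this
    simp at this
  refine ⟨(C.deleteEdge s(a, c)).deleteEdge s(b, d),
    (isCMinor_deleteEdge C _ hac).trans (isCMinor_deleteEdge (C.deleteEdge s(a, c)) _ hbd), ?_⟩
  have nab : a ≠ b := by rintro rfl; simp [ha] at hb
  have nac : a ≠ c := by rintro rfl; simp [ha] at hc
  have nad : a ≠ d := by rintro rfl; simp [ha] at hd
  have nbc : b ≠ c := by rintro rfl; simp [hb] at hc
  have nbd : b ≠ d := by rintro rfl; simp [hb] at hd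
  have ncd : c ≠ d := by rintro rfl; simp [hc] at hd
  refine ⟨⟨Equiv.ofBijective f ⟨hf, hsurj⟩, ?_⟩, ?_⟩
  · intro x y
    change C.V at x y
    change (fromEdgeSet {s(0, 1), s(1, 2), s(2, 3), s(3, 0)} : SimpleGraph (Fin 4)).Adj
      (f x) (f y) ↔
      ((C.G.deleteEdges {s(a, c)}).deleteEdges {s(b, d)}).Adj x y
    rw [deleteEdges_adj, deleteEdges_adj]
    rcases h4 x with rfl | rfl | rfl | rfl <;> rcases h4 y with rfl | rfl | rfl | rfl <;>
      simp [ha, hb, hc, hd, hab', hcd', hbc, hda, hab'.symm, hcd'.symm, hbc.symm,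
        hda.symm, nab, nac, nad, nbc, nbd, ncd, nab.symm, nac.symm, nad.symm, nbc.symm, nbd.symm,
        ncd.symm]
  · change Sym2.map f '' C.X = constraintC4.X
    ext e
    constructor
    · rintro ⟨e', he', rfl⟩
      induction e' with | _ x y =>
      rcases M.xs x y he' with h | h
      · exact absurd (hf h) (C.G.ne_of_adj (M.wf he'))
      · exact h
    · rintro (rfl | rfl)
      · exact ⟨s(a, b), hab, by rw [Sym2.map_mk, ha, hb]⟩
      · exact ⟨s(c, d), hcd, by rw [Sym2.map_mk, hc, hd]⟩

theorem Model.minor : ∀ (n : ℕ) (C : CGraph) (f : C.V → Fin 4), Nat.card C.V = n → Model C f →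
    ∃ D, IsCMinor C D ∧ CGIso D constraintC4 := by
  intro n
  induction n with
  | zero =>
    intro C f hn M
    obtain ⟨a, -⟩ := M.e01
    have : Nonempty C.V := ⟨a⟩
    exact absurd hn Nat.card_pos.ne'
  | succ n ih =>
    intro C f hn M
    by_cases hf : Function.Injective f
    · exact M.of_injective hf
    · simp only [Function.Injective, not_forall] at hf
      obtain ⟨u, w, huw, hne⟩ := hf
      obtain ⟨v, hv, huv⟩ : ∃ v, f u = f v ∧ C.G.Adj u v := by
        by_contra hno
        push Not at hno
        have := M.cn (f u) {u} (by simp) ⟨u, rfl⟩ (by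
          intro x hx y hy hxy
          rw [Set.mem_singleton_iff] at hx
          subst hx
          exact absurd hxy (hno y (Eq.symm hy)))
        exact hne (this (a := w) huw.symm).symm
      obtain ⟨D, hD, hiso⟩ := ih (C.contract u v huv.ne) _ (by
        change Nat.card {w : C.V // w ≠ v} = n
        have : Nat.card {w : C.V // w ≠ v} = Nat.card C.V - 1 := by
          have := Set.ncard_compl ({v} : Set C.V)
          rw [Set.ncard_singleton] at this
          rw [← this]; rfl
        omega) (M.contract huv.ne hv)
      exact ⟨D, Relation.ReflTransGen.head (CMinorStep.contr C u v huv) hD, hiso⟩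

theorem contract_connected (C : CGraph) (u v : C.V) (huv : u ≠ v) (h : EdgeSetConnected C.X) :
    EdgeSetConnected (C.contract u v huv).X := by
  have hsup : ∀ p ∈ (fromEdgeSet (C.contract u v huv).X).support,
      ∃ x ∈ (fromEdgeSet C.X).support, contractFun huv x = p := by
    rintro p ⟨q, hpq⟩
    replace hpq := (fromEdgeSet_adj _).1 hpq
    obtain ⟨⟨⟨e', he', he⟩, -⟩, hne⟩ := hpq
    induction e' with | _ x y =>
    have hxy : x ≠ y := by
      rintro rfl
      replace he := Sym2.eq_iff.1 he
      rcases he with ⟨h1, h2⟩ | ⟨h1, h2⟩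
      · exact hne (h1.symm.trans h2)
      · exact hne (h2.symm.trans h1)
    have hadj : (fromEdgeSet C.X).Adj x y := (fromEdgeSet_adj _).2 ⟨he', hxy⟩
    replace he := Sym2.eq_iff.1 he
    rcases he with ⟨h1, h2⟩ | ⟨h1, h2⟩
    · exact ⟨x, ⟨y, hadj⟩, h1⟩
    · exact ⟨y, ⟨x, hadj.symm⟩, h2⟩
  have hwalk : ∀ x y, (fromEdgeSet C.X).Walk x y →
      (fromEdgeSet (C.contract u v huv).X).Reachable (contractFun huv x) (contractFun huv y) := by
    intro x y w
    induction w with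
    | nil => exact Reachable.refl _
    | @cons a b c hab w ih =>
      refine Reachable.trans ?_ ih
      by_cases hc : contractFun huv a = contractFun huv b
      · rw [hc]; exact Reachable.refl _
      · exact Adj.reachable ((fromEdgeSet_adj _).2
          ⟨⟨⟨s(a, b), ((fromEdgeSet_adj _).1 hab).1, rfl⟩, fun hdd => hc (Sym2.mk_isDiag_iff.1 hdd)⟩, hc⟩)
  intro p hp q hq
  obtain ⟨x, hx, rfl⟩ := hsup p hp
  obtain ⟨y, hy, rfl⟩ := hsup q hq
  obtain ⟨w⟩ := h x hx y hy
  exact hwalk x y w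

theorem minor_connected {C D : CGraph} (h : EdgeSetConnected C.X) (hD : IsCMinor C D) :
    EdgeSetConnected D.X := by
  induction hD with
  | refl => exact h
  | tail _ hs ih =>
    cases hs with
    | del e he hx => exact ih
    | contr u v huv => exact contract_connected _ u v _ ih

theorem not_connected_of_iso {D : CGraph} (h : CGIso D constraintC4) :
    ¬ EdgeSetConnected D.X := by
  obtain ⟨φ, hφ⟩ := h
  intro hc
  have hsupp : ∀ i j : Fin 4, i ≠ j → s(i, j) ∈ constraintC4.X →
      ∃ x ∈ (fromEdgeSet D.X).support, φ x = i := by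
    intro i j hij hs
    rw [← hφ] at hs
    obtain ⟨e, he, hes⟩ := hs
    induction e with | _ x y =>
    have hxy : x ≠ y := by
      rintro rfl
      replace hes := Sym2.eq_iff.1 hes
      rcases hes with ⟨h1, h2⟩ | ⟨h1, h2⟩
      · exact hij (h1.symm.trans h2)
      · exact hij (h2.symm.trans h1)
    have hadj : (fromEdgeSet D.X).Adj x y := (fromEdgeSet_adj _).2 ⟨he, hxy⟩
    replace hes := Sym2.eq_iff.1 hes
    rcases hes with ⟨h1, h2⟩ | ⟨h1, h2⟩
    · exact ⟨x, ⟨y, hadj⟩, h1⟩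
    · exact ⟨y, ⟨x, hadj.symm⟩, h2⟩
  obtain ⟨x, hx, hx0⟩ := hsupp (0 : Fin 4) (1 : Fin 4) (by decide) (Or.inl rfl)
  obtain ⟨y, hy, hy2⟩ := hsupp (2 : Fin 4) (3 : Fin 4) (by decide) (Or.inr rfl)
  have hwalk : ∀ x y, (fromEdgeSet D.X).Walk x y →
      (φ x = (0 : Fin 4) ∨ φ x = (1 : Fin 4)) → (φ y = (0 : Fin 4) ∨ φ y = (1 : Fin 4)) := by
    intro x y w
    induction w with
    | nil => exact id
    | @cons a b c hab w ih =>
      intro ha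
      apply ih
      have hm : s(φ a, φ b) ∈ constraintC4.X := by
        rw [← hφ]
        exact ⟨s(a, b), ((fromEdgeSet_adj _).1 hab).1, rfl⟩
      have aux : ∀ i j : Fin 4, s(i, j) ∈ ({s(0, 1), s(2, 3)} : Set (Sym2 (Fin 4))) →
          (i = 0 ∨ i = 1) → (j = 0 ∨ j = 1) := by
        intro i j
        simp only [Set.mem_insert_iff, Set.mem_singleton_iff]
        revert i j
        decide
      exact aux _ _ hm ha
  obtain ⟨w⟩ := hc x hx y hy
  have := hwalk x y w (Or.inl hx0)
  have h20 : ((2 : Fin 4) = 0 ∨ (2 : Fin 4) = 1) := by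
    rcases this with h | h
    · exact Or.inl (hy2.symm.trans h)
    · exact Or.inr (hy2.symm.trans h)
  exact absurd h20 (by decide)

theorem exists_model (C : CGraph) (hWF : C.WF) (h2 : KConnected 2 C.G)
    (hdis : ¬ EdgeSetConnected C.X) : ∃ f : C.V → Fin 4, Model C f := by
  classical
  obtain ⟨A, B, R, D, hA, hB, hR, hD, hAB, hRD, hun, hX, ⟨a, ha, b, hb, hab⟩,
    ⟨b', hb', c', hc', hbc⟩, ⟨c, hc, d, hd, hcd⟩, ⟨d', hd', a', ha', hda⟩⟩ :=
    four_parts C.G C.X hWF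
      (by
        have := Cn.of_induce (h2.2 ∅ (by simp))
        rwa [Set.compl_empty] at this)
      (fun v => Cn.of_induce (h2.2 {v} (by simp))) hdis
  have hAB' : ∀ x, x ∈ A → x ∉ B := fun x h1 h2 => Set.disjoint_left.1 hAB h1 h2
  have hRD' : ∀ x, x ∈ R → x ∉ D := fun x h1 h2 => Set.disjoint_left.1 hRD h1 h2
  have hun' : ∀ x, (x ∈ A ∨ x ∈ B) ↔ ¬ (x ∈ R ∨ x ∈ D) := by
    intro x
    have : x ∈ A ∪ B ↔ x ∈ (R ∪ D)ᶜ := by rw [hun]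
    simpa only [Set.mem_union, Set.mem_compl_iff] using this
  let f : C.V → Fin 4 := fun x => if x ∈ A then 0 else if x ∈ B then 1 else if x ∈ R then 2 else 3
  have f0 : ∀ x, f x = 0 ↔ x ∈ A := by
    intro x; simp only [f]; split_ifs <;> simp_all
  have f1 : ∀ x, f x = 1 ↔ x ∈ B := by
    intro x; have := hAB' x; simp only [f]; split_ifs <;> simp_all
  have f2 : ∀ x, f x = 2 ↔ x ∈ R := by
    intro x; have := hun' x; simp only [f]; split_ifs <;> simp_all
  have f3 : ∀ x, f x = 3 ↔ x ∈ D := by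
    intro x; have h1 := hun' x; have h2 := hRD' x; simp only [f]; split_ifs <;> simp_all
  refine ⟨f, hWF, ?_, ?_, ⟨a, b, (f0 a).2 ha, (f1 b).2 hb, hab⟩,
    ⟨b', c', (f1 _).2 hb', (f2 _).2 hc', hbc⟩, ⟨c, d, (f2 c).2 hc, (f3 d).2 hd, hcd⟩,
    ⟨d', a', (f3 _).2 hd', (f0 _).2 ha', hda⟩⟩
  · have e0 : f ⁻¹' {0} = A := Set.ext f0
    have e1 : f ⁻¹' {1} = B := Set.ext f1
    have e2 : f ⁻¹' {2} = R := Set.ext f2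
    have e3 : f ⁻¹' {3} = D := Set.ext f3
    intro i
    have hi : i = 0 ∨ i = 1 ∨ i = 2 ∨ i = 3 := by revert i; decide
    rcases hi with rfl | rfl | rfl | rfl
    · rwa [e0]
    · rwa [e1]
    · rwa [e2]
    · rwa [e3]
  · intro u v huv
    have h1 : (f u = 0 ∨ f u = 1) → (f v = 0 ∨ f v = 1) := by
      rw [f0, f1, f0, f1]; exact fun h => hX u h v huv
    have h2 : (f v = 0 ∨ f v = 1) → (f u = 0 ∨ f u = 1) := by
      rw [f0, f1, f0, f1]; exact fun h => hX v h u (by rw [Sym2.eq_swap]; exact huv)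
    have aux : ∀ i j : Fin 4, ((i = 0 ∨ i = 1) → (j = 0 ∨ j = 1)) →
        ((j = 0 ∨ j = 1) → (i = 0 ∨ i = 1)) →
        i = j ∨ (s(i, j) = s(0, 1) ∨ s(i, j) = s(2, 3)) := by decide
    exact aux _ _ h1 h2

end Minor

/-- A 2-connected constraint graph is constraint connected iff it has no constraint minor
isomorphic to the 4-cycle whose constraint consists of two opposite edges. -/
theorem two_connected_constraint_connected_iff (C : CGraph) (hWF : C.WF)
    (h2 : KConnected 2 C.G) :
    EdgeSetConnected C.X ↔ ¬ ∃ D, IsCMinor C D ∧ CGIso D constraintC4 := by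
  constructor
  · rintro h ⟨D, hD, hiso⟩
    exact not_connected_of_iso hiso (minor_connected h hD)
  · intro h
    by_contra hdis
    obtain ⟨f, M⟩ := exists_model C hWF h2 hdis
    exact h (Model.minor _ C f rfl M)
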